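/- Let Q = GR(a,b,c,d), let t ∈ ℤ, and let S ⊆ X_t be finite and closed under intervals. Let M be the complex vector space with basis {f_λ : λ ∈ S}, and for each arrow α of Q from u to v define the linear map M_α : M → M on the basis by M_α(f_λ) = f_{λ+wt(α)} if (a·λ₁ + b·λ₂ − c·λ₃ − d·λ₄ = t + u and λ + wt(α) ∈ S), and M_α(f_λ) = 0 otherwise. Then for a subset R ⊆ S, the linear span of {f_λ : λ ∈ R} is invariant under M_α for every arrow α of Q if and only if R is an order filter of S. -/

import Mathlib

/-- Weight vectors in `ℤ⁴`. -/
abbrev V4 : Type := Fin 4 → ℤ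

/-- The eight possible types of arrows in a Gale–Robinson quiver. -/
inductive GRArrowType : Type
  | E | W | S | N | SE | NE | SW | NW
  deriving DecidableEq

/-- The weight in `ℤ⁴` of each arrow type. -/
def GRwt : GRArrowType → V4
  | .E  => ![1, 0, 0, 0]
  | .W  => ![0, 1, 0, 0]
  | .S  => ![0, 0, 1, 0]
  | .N  => ![0, 0, 0, 1]
  | .SE => ![1, 0, 1, 0]
  | .NE => ![1, 0, 0, 1]
  | .SW => ![0, 1, 1, 0]
  | .NW => ![0, 1, 0, 1]

/-- `IsGRArrow a b c d N τ i j` : the Gale–Robinson quiver `GR(a,b,c,d)` (on vertex set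
`{1,…,N}`) has an arrow of type `τ` from `i` to `j`. -/
def IsGRArrow (a b c d N : ℤ) : GRArrowType → ℤ → ℤ → Prop
  | .E,  i, j => 1 ≤ i ∧ i ≤ N ∧ 1 ≤ j ∧ j ≤ N ∧ j = i + a
  | .W,  i, j => 1 ≤ i ∧ i ≤ N ∧ 1 ≤ j ∧ j ≤ N ∧ j = i + b
  | .S,  i, j => 1 ≤ i ∧ i ≤ N ∧ 1 ≤ j ∧ j ≤ N ∧ j = i - c
  | .N,  i, j => 1 ≤ i ∧ i ≤ N ∧ 1 ≤ j ∧ j ≤ N ∧ j = i - d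
  | .SE, i, j => 1 ≤ i ∧ i ≤ N ∧ 1 ≤ j ∧ j ≤ N ∧ j = i + a - c ∧ N < i + a ∧ i - c < 1
  | .NE, i, j => 1 ≤ i ∧ i ≤ N ∧ 1 ≤ j ∧ j ≤ N ∧ j = i + a - d ∧ N < i + a ∧ i - d < 1
  | .SW, i, j => 1 ≤ i ∧ i ≤ N ∧ 1 ≤ j ∧ j ≤ N ∧ j = i + b - c ∧ N < i + b ∧ i - c < 1
  | .NW, i, j => 1 ≤ i ∧ i ≤ N ∧ 1 ≤ j ∧ j ≤ N ∧ j = i + b - d ∧ N < i + b ∧ i - d < 1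

/-- Paths in the Gale–Robinson quiver `GR(a,b,c,d)` (arrows are appended on the left,
`nil` is the lazy path at a vertex of `{1,…,N}`). -/
inductive GRPath (a b c d N : ℤ) : ℤ → ℤ → Type
  | nil (i : ℤ) (h1 : 1 ≤ i) (h2 : i ≤ N) : GRPath a b c d N i i
  | cons {i j k : ℤ} (τ : GRArrowType) (h : IsGRArrow a b c d N τ j k)
      (p : GRPath a b c d N i j) : GRPath a b c d N i k

/-- The weight of a path: the sum in `ℤ⁴` of the weights of its arrows. -/
def GRPath.wt {a b c d N : ℤ} : {i j : ℤ} → GRPath a b c d N i j → V4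
  | _, _, .nil _ _ _ => 0
  | _, _, .cons τ _ p => p.wt + GRwt τ

/-- The linear form `λ ↦ a·λ₁ + b·λ₂ − c·λ₃ − d·λ₄`. -/
def linS (a b c d : ℤ) (l : V4) : ℤ := a * l 0 + b * l 1 - c * l 2 - d * l 3

/-- Membership in the poset `X_t = {λ ∈ ℤ⁴ : t+1 ≤ a·λ₁ + b·λ₂ − c·λ₃ − d·λ₄ ≤ t+N}`. -/
def InX (a b c d N t : ℤ) (l : V4) : Prop :=
  t + 1 ≤ linS a b c d l ∧ linS a b c d l ≤ t + N

/-- `S ⊆ X_t` is closed under intervals. -/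
def IntervalClosed (a b c d N t : ℤ) (S : Set V4) : Prop :=
  ∀ x ∈ S, ∀ z ∈ S, ∀ y : V4, InX a b c d N t y → x ≤ y → y ≤ z → y ∈ S

open Classical in
/-- The linear map `M_α` of the calibrated representation `M(S,t)` associated to an
arrow `α` of type `τ` with source `u`: on the basis vector `f_λ = single λ 1` it is
`f_{λ + wt α}` if `λ ∈ S`, `a·λ₁ + b·λ₂ − c·λ₃ − d·λ₄ = t + u` and `λ + wt α ∈ S`, and
`0` otherwise. -/
noncomputable def calMap (a b c d t : ℤ) (S : Set V4) (τ : GRArrowType) (u : ℤ) :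
    (V4 →₀ ℂ) →ₗ[ℂ] (V4 →₀ ℂ) :=
  Finsupp.lsum ℂ fun l =>
    if l ∈ S ∧ linS a b c d l = t + u ∧ l + GRwt τ ∈ S then
      Finsupp.lsingle (l + GRwt τ)
    else 0

theorem linS_add (a b c d : ℤ) (l k : V4) :
    linS a b c d (l + k) = linS a b c d l + linS a b c d k := by
  simp only [linS, Pi.add_apply]; ring

theorem arrow_bounds {a b c d N : ℤ} {τ : GRArrowType} {u v : ℤ}
    (h : IsGRArrow a b c d N τ u v) : 1 ≤ v ∧ v ≤ N := by
  cases τ <;> simp only [IsGRArrow] at h <;> omega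

theorem GRwt_nonneg (τ : GRArrowType) : 0 ≤ GRwt τ := by
  intro i
  cases τ <;> fin_cases i <;> simp [GRwt]

theorem GRwt_sum_pos (τ : GRArrowType) :
    0 < GRwt τ 0 + GRwt τ 1 + GRwt τ 2 + GRwt τ 3 := by
  cases τ <;> simp [GRwt]

set_option maxHeartbeats 2000000 in
theorem exists_step (a b c d N t : ℤ)
    (ha : 0 < a) (hb : 0 < b) (hc : 0 < c) (hd : 0 < d)
    (hab : a + b = N) (hcd : c + d = N) (l m : V4)
    (hl : InX a b c d N t l) (hm : InX a b c d N t m) (hlm : l ≤ m) (hne : l ≠ m) :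
    ∃ τ, IsGRArrow a b c d N τ (linS a b c d l - t) (linS a b c d (l + GRwt τ) - t) ∧
      l + GRwt τ ≤ m := by
  obtain ⟨hl1, hl2⟩ := hl
  obtain ⟨hm1, hm2⟩ := hm
  have h0 : l 0 ≤ m 0 := hlm 0
  have h1 : l 1 ≤ m 1 := hlm 1
  have h2 : l 2 ≤ m 2 := hlm 2
  have h3 : l 3 ≤ m 3 := hlm 3
  have hdiff : linS a b c d m = linS a b c d l + a * (m 0 - l 0) + b * (m 1 - l 1)
      - c * (m 2 - l 2) - d * (m 3 - l 3) := by
    simp only [linS]; ring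
  simp only [linS_add]
  have key : ∀ τ, (l + GRwt τ ≤ m ↔ (l 0 + GRwt τ 0 ≤ m 0 ∧ l 1 + GRwt τ 1 ≤ m 1 ∧
      l 2 + GRwt τ 2 ≤ m 2 ∧ l 3 + GRwt τ 3 ≤ m 3)) := by
    intro τ
    simp [Pi.le_def, Fin.forall_fin_succ]
  simp only [key]
  have hne' : ¬ (m 0 = l 0 ∧ m 1 = l 1 ∧ m 2 = l 2 ∧ m 3 = l 3) := by
    rintro ⟨e0, e1, e2, e3⟩
    apply hne
    funext i
    fin_cases i <;> simp [*]
  generalize linS a b c d l = s at *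
  generalize linS a b c d m = s' at *
  by_contra hcon
  have hE := fun h => hcon ⟨.E, h⟩
  have hW := fun h => hcon ⟨.W, h⟩
  have hS := fun h => hcon ⟨.S, h⟩
  have hN := fun h => hcon ⟨.N, h⟩
  have hSE := fun h => hcon ⟨.SE, h⟩
  have hNE := fun h => hcon ⟨.NE, h⟩
  have hSW := fun h => hcon ⟨.SW, h⟩
  have hNW := fun h => hcon ⟨.NW, h⟩
  clear hcon key
  simp [IsGRArrow, GRwt, linS] at hE hW hS hN hSE hNE hSW hNW
  have p0 : m 0 = l 0 ∨ a ≤ a * (m 0 - l 0) := by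
    rcases h0.eq_or_lt with h | h
    · exact Or.inl h.symm
    · right; nlinarith
  have p1 : m 1 = l 1 ∨ b ≤ b * (m 1 - l 1) := by
    rcases h1.eq_or_lt with h | h
    · exact Or.inl h.symm
    · right; nlinarith
  have p2 : m 2 = l 2 ∨ c ≤ c * (m 2 - l 2) := by
    rcases h2.eq_or_lt with h | h
    · exact Or.inl h.symm
    · right; nlinarith
  have p3 : m 3 = l 3 ∨ d ≤ d * (m 3 - l 3) := by
    rcases h3.eq_or_lt with h | h
    · exact Or.inl h.symm
    · right; nlinarith
  have z0 : m 0 = l 0 → a * (m 0 - l 0) = 0 := by intro h; simp [h]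
  have z1 : m 1 = l 1 → b * (m 1 - l 1) = 0 := by intro h; simp [h]
  have z2 : m 2 = l 2 → c * (m 2 - l 2) = 0 := by intro h; simp [h]
  have z3 : m 3 = l 3 → d * (m 3 - l 3) = 0 := by intro h; simp [h]
  generalize a * (m 0 - l 0) = q0 at *
  generalize b * (m 1 - l 1) = q1 at *
  generalize c * (m 2 - l 2) = q2 at *
  generalize d * (m 3 - l 3) = q3 at *
  generalize m 0 = m0 at *
  generalize m 1 = m1 at *
  generalize m 2 = m2 at *
  generalize m 3 = m3 at *
  generalize l 0 = l0 at *
  generalize l 1 = l1 at *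
  generalize l 2 = l2 at *
  generalize l 3 = l3 at *
  clear hlm hne
  have hE' : ¬ (s - t + a ≤ N ∧ l0 + 1 ≤ m0) := by
    clear * - hE h0 h1 h2 h3 hl1 hl2 ha hb hc hd hab hcd
    omega
  have hW' : ¬ (s - t + b ≤ N ∧ l1 + 1 ≤ m1) := by
    clear * - hW h0 h1 h2 h3 hl1 hl2 ha hb hc hd hab hcd
    omega
  have hS' : ¬ (1 ≤ s - t - c ∧ l2 + 1 ≤ m2) := by
    clear * - hS h0 h1 h2 h3 hl1 hl2 ha hb hc hd hab hcd
    omega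
  have hN' : ¬ (1 ≤ s - t - d ∧ l3 + 1 ≤ m3) := by
    clear * - hN h0 h1 h2 h3 hl1 hl2 ha hb hc hd hab hcd
    omega
  have hSE' : ¬ (N < s - t + a ∧ s - t - c < 1 ∧ l0 + 1 ≤ m0 ∧ l2 + 1 ≤ m2) := by
    clear * - hSE h0 h1 h2 h3 hl1 hl2 ha hb hc hd hab hcd
    omega
  have hNE' : ¬ (N < s - t + a ∧ s - t - d < 1 ∧ l0 + 1 ≤ m0 ∧ l3 + 1 ≤ m3) := by
    clear * - hNE h0 h1 h2 h3 hl1 hl2 ha hb hc hd hab hcd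
    omega
  have hSW' : ¬ (N < s - t + b ∧ s - t - c < 1 ∧ l1 + 1 ≤ m1 ∧ l2 + 1 ≤ m2) := by
    clear * - hSW h0 h1 h2 h3 hl1 hl2 ha hb hc hd hab hcd
    omega
  have hNW' : ¬ (N < s - t + b ∧ s - t - d < 1 ∧ l1 + 1 ≤ m1 ∧ l3 + 1 ≤ m3) := by
    clear * - hNW h0 h1 h2 h3 hl1 hl2 ha hb hc hd hab hcd
    omega
  clear hE hW hS hN hSE hNE hSW hNW
  have n02 : ¬ (l0 < m0 ∧ l2 < m2) := by clear * - hE' hS' hSE'; omega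
  have n03 : ¬ (l0 < m0 ∧ l3 < m3) := by clear * - hE' hN' hNE'; omega
  have n12 : ¬ (l1 < m1 ∧ l2 < m2) := by clear * - hW' hS' hSW'; omega
  have n13 : ¬ (l1 < m1 ∧ l3 < m3) := by clear * - hW' hN' hNW'; omega
  clear hSE' hNE' hSW' hNW'
  by_cases hp : l0 < m0 ∨ l1 < m1
  · have e2 : m2 = l2 := by clear * - hp n02 n12 h2; omega
    have e3 : m3 = l3 := by clear * - hp n03 n13 h3; omega
    have y2 := z2 e2
    have y3 := z3 e3
    clear hS' hN' n02 n03 n12 n13 z2 z3 p2 p3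
    omega
  · have e0 : m0 = l0 := by clear * - hp h0; omega
    have e1 : m1 = l1 := by clear * - hp h1; omega
    have y0 := z0 e0
    have y1 := z1 e1
    clear hE' hW' n02 n03 n12 n13 z0 z1 p0 p1 hp
    omega

theorem single_mem_span_iff (R : Set V4) (l : V4) :
    Finsupp.single l (1 : ℂ) ∈
      Submodule.span ℂ ((fun l => Finsupp.single l (1 : ℂ)) '' R) ↔ l ∈ R := by
  rw [← Finsupp.supported_eq_span_single, Finsupp.mem_supported,
    Finsupp.support_single_ne_zero _ one_ne_zero]
  simp

open Classical in
theorem calMap_single (a b c d t : ℤ) (S : Set V4) (τ : GRArrowType) (u : ℤ) (l : V4) :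
    calMap a b c d t S τ u (Finsupp.single l 1) =
      if l ∈ S ∧ linS a b c d l = t + u ∧ l + GRwt τ ∈ S then
        Finsupp.single (l + GRwt τ) 1 else 0 := by
  rw [calMap, Finsupp.lsum_single]
  split_ifs <;> simp

/-- For `S ⊆ X_t` finite and closed under intervals and `R ⊆ S`, the
span of `{f_λ : λ ∈ R}` is invariant under `M_α` for every arrow `α` of `GR(a,b,c,d)`
iff `R` is an order filter of `S`. -/
theorem calibrated_invariant_span_iff_orderFilter (a b c d N t : ℤ)
    (ha : 0 < a) (hb : 0 < b) (hc : 0 < c) (hd : 0 < d)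
    (hab : a + b = N) (hcd : c + d = N)
    (S : Set V4) (hSX : ∀ l ∈ S, InX a b c d N t l) (hfin : S.Finite)
    (hIC : IntervalClosed a b c d N t S)
    (R : Set V4) (hRS : R ⊆ S) :
    (∀ (τ : GRArrowType) (u v : ℤ), IsGRArrow a b c d N τ u v →
        ∀ x ∈ Submodule.span ℂ ((fun l => Finsupp.single l (1 : ℂ)) '' R),
          calMap a b c d t S τ u x ∈
            Submodule.span ℂ ((fun l => Finsupp.single l (1 : ℂ)) '' R)) ↔
      (∀ l ∈ R, ∀ m ∈ S, l ≤ m → m ∈ R) := by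
  constructor
  · intro hinv
    have main : ∀ n : ℕ, ∀ l ∈ R, ∀ m ∈ S, l ≤ m →
        (m 0 - l 0) + (m 1 - l 1) + (m 2 - l 2) + (m 3 - l 3) ≤ n → m ∈ R := by
      intro n
      induction n with
      | zero =>
        intro l hl m hm hlm hn
        have h0 : l 0 ≤ m 0 := hlm 0
        have h1 : l 1 ≤ m 1 := hlm 1
        have h2 : l 2 ≤ m 2 := hlm 2
        have h3 : l 3 ≤ m 3 := hlm 3
        have : l = m := by
          funext i
          fin_cases i <;> simp <;> omega
        exact this ▸ hl
      | succ n ih =>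
        intro l hl m hm hlm hn
        by_cases hne : l = m
        · exact hne ▸ hl
        obtain ⟨τ, harr, hle⟩ := exists_step a b c d N t ha hb hc hd hab hcd l m
          (hSX l (hRS hl)) (hSX m hm) hlm hne
        have hb' := arrow_bounds harr
        have hS' : l + GRwt τ ∈ S := by
          refine hIC l (hRS hl) m hm _ ⟨by linarith [hb'.1], by linarith [hb'.2]⟩ ?_ hle
          exact le_add_of_nonneg_right (GRwt_nonneg τ)
        have hmem := hinv τ _ _ harr _ ((single_mem_span_iff R l).2 hl)
        rw [calMap_single, if_pos ⟨hRS hl, by ring, hS'⟩, single_mem_span_iff] at hmem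
        refine ih _ hmem m hm hle ?_
        have := GRwt_sum_pos τ
        simp only [Pi.add_apply]
        push_cast at hn
        linarith
    intro l hl m hm hlm
    exact main _ l hl m hm hlm (Int.self_le_toNat _)
  · intro hfil τ u v _ x hx
    induction hx using Submodule.span_induction with
    | mem x hx =>
      obtain ⟨l, hl, rfl⟩ := hx
      simp only [calMap_single]
      split_ifs with h
      · rw [single_mem_span_iff]
        exact hfil l hl _ h.2.2 (le_add_of_nonneg_right (GRwt_nonneg τ))
      · exact Submodule.zero_mem _
    | zero => simp
    | add x y _ _ hx hy => rw [map_add]; exact Submodule.add_mem _ hx hy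
    | smul r x _ hx => rw [map_smul]; exact Submodule.smul_mem _ _ hx
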